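/- (Abstraction theorem for the Dining Cryptographers protocol, semantic form.) Let M and M^a be epistemic Kripke structures over Var and a finite type Agt of agents, with worlds W and W^a respectively, let (E, e₁, e₂) be a key-sharing graph on Agt, and let m : Agt → W → ZMod 2 and m^a : Agt → W^a → ZMod 2 be message functions. Assume: (i) R is a bisimulation between M and M^a; (ii) whenever u R u' then m j u = m^a j u' for all j ∈ Agt; (iii) for every agent i, whenever u ∼^M_i v then m i u = m i v (each agent knows its own message); and (iv) for every agent i, the graph is connected on Agt ∖ {i} using the edges in E ∖ keys(i). Then the relation ℜ defined by (u,κ) ℜ u' iff u R u' is a bisimulation (i.e., satisfies Atoms, Forth and Back with respect to the variables Var ⊕ {rr} and the agents Agt) between the concrete DC structure DC(M,m) and the abstract DC structure DC^a(M^a,m^a). -/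

import Mathlib

/-- An epistemic Kripke structure over variables `Var` and agents `Agt`,
with worlds `W`: for each agent an equivalence relation on worlds, and a
Boolean valuation of the variables at each world. -/
structure Kripke (Var Agt W : Type*) where
  rel : Agt → W → W → Prop
  equiv : ∀ i, Equivalence (rel i)
  val : W → Var → Bool

/-- Formulas of the epistemic language `L(Var, Agt)`:
`⊤ | v | ¬φ | φ ∧ φ | K_i φ`. -/
inductive EFormula (Var Agt : Type*) : Type _ where
  | top : EFormula Var Agt
  | var : Var → EFormula Var Agt
  | neg : EFormula Var Agt → EFormula Var Agt
  | and : EFormula Var Agt → EFormula Var Agt → EFormula Var Agt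
  | know : Agt → EFormula Var Agt → EFormula Var Agt

/-- Satisfaction `M, w ⊨ φ`. -/
def Kripke.Sat {Var Agt W : Type*} (M : Kripke Var Agt W) : W → EFormula Var Agt → Prop
  | _, .top => True
  | w, .var v => M.val w v = true
  | w, .neg φ => ¬ M.Sat w φ
  | w, .and φ ψ => M.Sat w φ ∧ M.Sat w ψ
  | w, .know i φ => ∀ w', M.rel i w w' → M.Sat w' φ

/-- A bisimulation between two epistemic Kripke structures over the same
`Var` and `Agt`: the Atoms, Forth and Back conditions. -/
def Bisim {Var Agt W₁ W₂ : Type*} (M : Kripke Var Agt W₁) (N : Kripke Var Agt W₂)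
    (R : W₁ → W₂ → Prop) : Prop :=
  (∀ w u, R w u → ∀ v, M.val w v = N.val u v) ∧
  (∀ i w₁ w₂ u₁, M.rel i w₁ w₂ → R w₁ u₁ → ∃ u₂, N.rel i u₁ u₂ ∧ R w₂ u₂) ∧
  (∀ i u₁ u₂ w₁, N.rel i u₁ u₂ → R w₁ u₁ → ∃ w₂, M.rel i w₁ w₂ ∧ R w₂ u₂)


/-- The set of edges incident on agent `j` (the keys held by `j`). -/
def dcKeys {Agt E : Type*} (e1 e2 : E → Agt) (j : Agt) : Set E :=
  {ε | e1 ε = j ∨ e2 ε = j}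

/-- The exclusive-or (sum in `ZMod 2`) of the values of `d` over the edges
incident on agent `j`. -/
def keySum {Agt E : Type*} [Fintype E] [DecidableEq Agt]
    (e1 e2 : E → Agt) (j : Agt) (d : E → ZMod 2) : ZMod 2 :=
  ∑ ε ∈ Finset.univ.filter (fun ε => e1 ε = j ∨ e2 ε = j), d ε

/-- One step between agents `x` and `y` within the set `S` of agents, along
an edge from `F` whose two endpoints are `x` and `y`. -/
def EdgeStep {Agt E : Type*} (e1 e2 : E → Agt) (F : Set E) (S : Set Agt)
    (x y : Agt) : Prop :=
  x ∈ S ∧ y ∈ S ∧ ∃ ε ∈ F, (e1 ε = x ∧ e2 ε = y) ∨ (e1 ε = y ∧ e2 ε = x)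

/-- The graph is connected on the set `S` of agents using the set `F` of edges:
any two agents of `S` are joined by a finite path of edges from `F` all of
whose agents lie in `S`. -/
def ConnectedOn {Agt E : Type*} (e1 e2 : E → Agt) (S : Set Agt) (F : Set E) : Prop :=
  ∀ x ∈ S, ∀ y ∈ S, Relation.ReflTransGen (EdgeStep e1 e2 F S) x y

/-- The concrete DC structure `DC(M, m)`: worlds are pairs of a world of `M`
and a key assignment `κ : E → ZMod 2`; agent `i` cannot distinguish two worlds
iff they are `∼_i`-related in `M`, agree on the keys incident on `i`, and give
rise to the same broadcast by each agent; the valuation extends that of `M`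
by assigning to the fresh variable `rr` the xor of all messages. -/
def DCconc {Var Agt W E : Type*} [Fintype Agt] [Fintype E] [DecidableEq Agt]
    (M : Kripke Var Agt W) (e1 e2 : E → Agt) (m : Agt → W → ZMod 2) :
    Kripke (Var ⊕ Unit) Agt (W × (E → ZMod 2)) where
  rel i p q := M.rel i p.1 q.1 ∧ (∀ ε ∈ dcKeys e1 e2 i, p.2 ε = q.2 ε) ∧
    ∀ j, m j p.1 + keySum e1 e2 j p.2 = m j q.1 + keySum e1 e2 j q.2
  equiv i :=
    ⟨fun _ => ⟨(M.equiv i).refl _, fun _ _ => rfl, fun _ => rfl⟩,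
     fun h => ⟨(M.equiv i).symm h.1, fun ε hε => (h.2.1 ε hε).symm,
       fun j => (h.2.2 j).symm⟩,
     fun h h' => ⟨(M.equiv i).trans h.1 h'.1,
       fun ε hε => (h.2.1 ε hε).trans (h'.2.1 ε hε),
       fun j => (h.2.2 j).trans (h'.2.2 j)⟩⟩
  val p x :=
    match x with
    | Sum.inl v => M.val p.1 v
    | Sum.inr _ => decide ((∑ j, m j p.1) = 1)

/-- The abstract DC structure `DCᵃ(Mᵃ, mᵃ)` (trusted third party): the worlds
are unchanged; agent `i` cannot distinguish two worlds iff they are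
`∼_i`-related in `Mᵃ` and give the same xor of all messages; the valuation
extends that of `Mᵃ` by assigning the xor of all messages to `rr`. -/
def DCabs {Var Agt Wa : Type*} [Fintype Agt]
    (Ma : Kripke Var Agt Wa) (ma : Agt → Wa → ZMod 2) :
    Kripke (Var ⊕ Unit) Agt Wa where
  rel i u v := Ma.rel i u v ∧ (∑ j, ma j u) = (∑ j, ma j v)
  equiv i :=
    ⟨fun _ => ⟨(Ma.equiv i).refl _, rfl⟩,
     fun h => ⟨(Ma.equiv i).symm h.1, h.2.symm⟩,
     fun h h' => ⟨(Ma.equiv i).trans h.1 h'.1, h.2.trans h'.2⟩⟩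
  val u x :=
    match x with
    | Sum.inl v => Ma.val u v
    | Sum.inr _ => decide ((∑ j, ma j u) = 1)

theorem keySum_eq_ite {Agt E : Type*} [Fintype E] [DecidableEq Agt]
    (e1 e2 : E → Agt) (hloop : ∀ ε, e1 ε ≠ e2 ε) (j : Agt) (d : E → ZMod 2) :
    keySum e1 e2 j d
      = ∑ ε, ((if j = e1 ε then d ε else 0) + (if j = e2 ε then d ε else 0)) := by
  unfold keySum
  rw [Finset.sum_filter]
  refine Finset.sum_congr rfl fun ε _ => ?_
  have h := hloop ε
  by_cases h1 : e1 ε = j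
  · have h2 : e2 ε ≠ j := fun h2 => h (h1.trans h2.symm)
    simp [h1, h2, h2.symm]
  · by_cases h2 : e2 ε = j
    · simp [h2, Ne.symm h1]
    · simp [h1, h2, Ne.symm h1, Ne.symm h2]

theorem sum_keySum {Agt E : Type*} [Fintype Agt] [Fintype E] [DecidableEq Agt]
    (e1 e2 : E → Agt) (hloop : ∀ ε, e1 ε ≠ e2 ε) (d : E → ZMod 2) :
    ∑ j, keySum e1 e2 j d = 0 := by
  simp_rw [keySum_eq_ite e1 e2 hloop]
  rw [Finset.sum_comm]
  refine Finset.sum_eq_zero fun ε _ => ?_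
  rw [Finset.sum_add_distrib]
  simp [CharTwo.add_self_eq_zero]

theorem keySum_add {Agt E : Type*} [Fintype E] [DecidableEq Agt]
    (e1 e2 : E → Agt) (j : Agt) (d d' : E → ZMod 2) :
    keySum e1 e2 j (fun ε => d ε + d' ε) = keySum e1 e2 j d + keySum e1 e2 j d' :=
  Finset.sum_add_distrib

theorem path_keys {Agt E : Type*} [Fintype E] [DecidableEq Agt]
    (e1 e2 : E → Agt) (hloop : ∀ ε, e1 ε ≠ e2 ε) (i x y : Agt)
    (h : Relation.ReflTransGen
      (EdgeStep e1 e2 {ε | ε ∉ dcKeys e1 e2 i} {j | j ≠ i}) x y) :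
    ∃ d : E → ZMod 2, (∀ ε ∈ dcKeys e1 e2 i, d ε = 0) ∧
      ∀ j, keySum e1 e2 j d = (if j = x then 1 else 0) + (if j = y then 1 else 0) := by
  classical
  induction h with
  | refl =>
    exact ⟨fun _ => 0, fun _ _ => rfl, fun j => by
      rw [CharTwo.add_self_eq_zero]; simp [keySum]⟩
  | @tail b c _ hs ih =>
    obtain ⟨d, hd0, hd⟩ := ih
    obtain ⟨_, _, ε0, hε0, hends⟩ := hs
    have key : ∀ j, keySum e1 e2 j (fun ε => if ε = ε0 then 1 else 0)
        = (if j = b then 1 else 0) + (if j = c then 1 else 0) := by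
      intro j
      rw [keySum_eq_ite e1 e2 hloop, Finset.sum_eq_single ε0]
      · rcases hends with ⟨h1, h2⟩ | ⟨h1, h2⟩
        · simp [h1, h2]
        · simp [h1, h2, add_comm]
      · intro ε _ hne
        simp [hne]
      · simp
    refine ⟨fun ε => d ε + (if ε = ε0 then 1 else 0), ?_, ?_⟩
    · intro ε hε
      have hne : ε ≠ ε0 := by
        rintro rfl
        exact hε0 hε
      simp [hd0 ε hε, hne]
    · intro j
      rw [keySum_add, hd, key]
      linear_combination CharTwo.add_self_eq_zero (if j = b then (1 : ZMod 2) else 0)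

theorem exists_keys {Agt E : Type*} [Fintype Agt] [Fintype E] [DecidableEq Agt]
    (e1 e2 : E → Agt) (hloop : ∀ ε, e1 ε ≠ e2 ε) (i : Agt)
    (hconn : ConnectedOn e1 e2 {j | j ≠ i} {ε | ε ∉ dcKeys e1 e2 i})
    (t : Agt → ZMod 2) (hti : t i = 0) (hsum : ∑ j, t j = 0) :
    ∃ d : E → ZMod 2, (∀ ε ∈ dcKeys e1 e2 i, d ε = 0) ∧
      ∀ j, keySum e1 e2 j d = t j := by
  by_cases hr : ∃ r, r ≠ i
  · obtain ⟨r, hr⟩ := hr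
    have hx : ∀ x, ∃ d : E → ZMod 2, (∀ ε ∈ dcKeys e1 e2 i, d ε = 0) ∧
        ∀ j, t x * keySum e1 e2 j d
          = t x * ((if j = x then 1 else 0) + (if j = r then 1 else 0)) := by
      intro x
      by_cases hxi : x = i
      · subst hxi
        exact ⟨fun _ => 0, fun _ _ => rfl, fun j => by simp [hti]⟩
      · obtain ⟨d, h0, h1⟩ := path_keys e1 e2 hloop i x r (hconn x hxi r hr)
        exact ⟨d, h0, fun j => by rw [h1]⟩
    choose D hD0 hD using hx
    refine ⟨fun ε => ∑ x, t x * D x ε, ?_, ?_⟩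
    · intro ε hε
      exact Finset.sum_eq_zero fun x _ => by rw [hD0 x ε hε, mul_zero]
    · intro j
      have h1 : keySum e1 e2 j (fun ε => ∑ x, t x * D x ε)
          = ∑ x, t x * keySum e1 e2 j (D x) := by
        unfold keySum
        rw [Finset.sum_comm]
        simp_rw [Finset.mul_sum]
      rw [h1]
      simp_rw [hD, mul_add]
      rw [Finset.sum_add_distrib, ← Finset.sum_mul, hsum]
      simp
  · push Not at hr
    exact ⟨fun _ => 0, fun _ _ => rfl, fun j => by rw [hr j, hti]; simp [keySum]⟩

/-- abstraction theorem for the Dining Cryptographers protocol,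
semantic form: under hypotheses (i)–(iv), the relation `(u,κ) ℜ u' ↔ R u u'`
is a bisimulation between `DC(M,m)` and `DCᵃ(Mᵃ,mᵃ)`. -/
theorem dc_abstraction_bisim {Var Agt W Wa E : Type*}
    [Fintype Agt] [Fintype E] [DecidableEq Agt]
    (M : Kripke Var Agt W) (Ma : Kripke Var Agt Wa)
    (e1 e2 : E → Agt) (hloop : ∀ ε, e1 ε ≠ e2 ε)
    (m : Agt → W → ZMod 2) (ma : Agt → Wa → ZMod 2)
    (R : W → Wa → Prop)
    (hbisim : Bisim M Ma R)
    (hmsg : ∀ u u', R u u' → ∀ j, m j u = ma j u')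
    (hown : ∀ i u v, M.rel i u v → m i u = m i v)
    (hconn : ∀ i, ConnectedOn e1 e2 {j | j ≠ i} {ε | ε ∉ dcKeys e1 e2 i}) :
    Bisim (DCconc M e1 e2 m) (DCabs Ma ma) (fun p u' => R p.1 u') := by
  obtain ⟨hat, hforth, hback⟩ := hbisim
  refine ⟨?_, ?_, ?_⟩
  · rintro ⟨w, κ⟩ u hR (v | _)
    · exact hat w u hR v
    · simp only [DCconc, DCabs]
      simp_rw [hmsg w u hR]
  · rintro i ⟨w₁, κ⟩ ⟨w₂, lam⟩ u₁ ⟨hrel, _, hb⟩ hR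
    obtain ⟨u₂, hu, hR2⟩ := hforth i w₁ w₂ u₁ hrel hR
    refine ⟨u₂, ⟨hu, ?_⟩, hR2⟩
    have h := Finset.sum_congr (rfl : (Finset.univ : Finset Agt) = _) fun j _ => hb j
    rw [Finset.sum_add_distrib, Finset.sum_add_distrib, sum_keySum e1 e2 hloop,
      sum_keySum e1 e2 hloop, add_zero, add_zero] at h
    simp_rw [← hmsg w₁ u₁ hR, ← hmsg w₂ u₂ hR2]
    exact h
  · rintro i u₁ u₂ ⟨w₁, κ⟩ ⟨hrel, hsum⟩ hR
    obtain ⟨w₂, hw, hR2⟩ := hback i u₁ u₂ w₁ hrel hR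
    simp_rw [← hmsg w₁ u₁ hR, ← hmsg w₂ u₂ hR2] at hsum
    obtain ⟨d, hd0, hd⟩ := exists_keys e1 e2 hloop i (hconn i)
      (fun j => m j w₁ + m j w₂)
      (by
        show m i w₁ + m i w₂ = 0
        rw [hown i w₁ w₂ hw, CharTwo.add_self_eq_zero])
      (by rw [Finset.sum_add_distrib, hsum, CharTwo.add_self_eq_zero])
    refine ⟨(w₂, fun ε => κ ε + d ε), ⟨hw, ?_, ?_⟩, hR2⟩
    · intro ε hε
      simp [hd0 ε hε]
    · intro j
      simp only [keySum_add, hd]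
      linear_combination -CharTwo.add_self_eq_zero (m j w₂)
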